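/- Let (α,β) be a seller superhedging strategy for an American option with adapted ℝ²-valued payoff process (ξ,ζ). Then for every mixed stopping time χ and every pair (P,S) ∈ barP(χ), E_P((ξ + Sζ)_χ) ≤ −θ_0(−α_0,−β_0). -/

import Mathlib

open MeasureTheory
open scoped Pointwise

noncomputable section

namespace RZ

variable {Ω : Type*} [Fintype Ω]

/-- `ω` and `ω'` lie in the same atom of the σ-field `m`. -/
def sameAtom (m : MeasurableSpace Ω) (ω ω' : Ω) : Prop :=
  ∀ A : Set Ω, MeasurableSet[m] A → (ω ∈ A ↔ ω' ∈ A)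

/-- Elementary conditional expectation w.r.t. a σ-field on a finite space:
at `ω` it is the `P`-average of `f` over the atom of `ω`. -/
def condExp (m : MeasurableSpace Ω) (P : Ω → ℝ) (f : Ω → ℝ) (ω : Ω) : ℝ :=
  (∑ ω' : Ω, Set.indicator {ω'' | sameAtom m ω ω''} (fun ω'' => P ω'' * f ω'') ω') /
  (∑ ω' : Ω, Set.indicator {ω'' | sameAtom m ω ω''} P ω')

/-- Expectation under `P`. -/
def expect (P : Ω → ℝ) (f : Ω → ℝ) : ℝ := ∑ ω : Ω, P ω * f ω

/-- Discrete market model with proportional transaction costs. -/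
structure Market (Ω : Type*) [Fintype Ω] where
  T : ℕ
  T_pos : 0 < T
  F : ℕ → MeasurableSpace Ω
  F_mono : ∀ ⦃s t : ℕ⦄, s ≤ t → F s ≤ F t
  F_zero : F 0 = ⊥
  F_top : F T = ⊤
  Q : Ω → ℝ
  Q_pos : ∀ ω, 0 < Q ω
  Q_sum : ∑ ω, Q ω = 1
  Sb : ℕ → Ω → ℝ
  Sa : ℕ → Ω → ℝ
  Sb_pos : ∀ t ω, t ≤ T → 0 < Sb t ω
  Sb_le_Sa : ∀ t ω, t ≤ T → Sb t ω ≤ Sa t ω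
  Sb_adapted : ∀ t, t ≤ T → Measurable[F t] (Sb t)
  Sa_adapted : ∀ t, t ≤ T → Measurable[F t] (Sa t)

variable (M : Market Ω)

/-- Liquidation value θ_t(γ, δ) in scenario ω, for a cash position γ and stock position δ. -/
def liq (t : ℕ) (ω : Ω) (γ δ : ℝ) : ℝ :=
  γ + M.Sb t ω * max δ 0 - M.Sa t ω * max (-δ) 0

/-- An adapted (real-valued) process. -/
def IsAdapted (X : ℕ → Ω → ℝ) : Prop := ∀ t, t ≤ M.T → Measurable[M.F t] (X t)

/-- An adapted ℝ²-valued payoff process. -/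
def AdaptedPair (ξ ζ : ℕ → Ω → ℝ) : Prop := IsAdapted M ξ ∧ IsAdapted M ζ

/-- Self-financing strategy. -/
def SelfFinancing (α β : ℕ → Ω → ℝ) : Prop :=
  Measurable[M.F 0] (α 0) ∧ Measurable[M.F 0] (β 0) ∧
  (∀ t, t < M.T → Measurable[M.F t] (α (t + 1)) ∧ Measurable[M.F t] (β (t + 1))) ∧
  (∀ t, t < M.T → ∀ ω, 0 ≤ liq M t ω (α t ω - α (t + 1) ω) (β t ω - β (t + 1) ω))

/-- Pure stopping time with values in {0,...,T}. -/
def IsStop (τ : Ω → ℕ) : Prop :=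
  (∀ ω, τ ω ≤ M.T) ∧ ∀ t : ℕ, MeasurableSet[M.F t] {ω | τ ω = t}

/-- Seller superhedging strategy. -/
def SellerHedge (ξ ζ α β : ℕ → Ω → ℝ) : Prop :=
  SelfFinancing M α β ∧
  ∀ τ, IsStop M τ → ∀ ω,
    0 ≤ liq M (τ ω) ω (α (τ ω) ω - ξ (τ ω) ω) (β (τ ω) ω - ζ (τ ω) ω)

/-- Buyer superhedging strategy. -/
def BuyerHedge (ξ ζ α β : ℕ → Ω → ℝ) : Prop :=
  SelfFinancing M α β ∧
  ∃ τ, IsStop M τ ∧ ∀ ω,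
    0 ≤ liq M (τ ω) ω (α (τ ω) ω + ξ (τ ω) ω) (β (τ ω) ω + ζ (τ ω) ω)

/-- Seller's (ask) price: infimum of the initial costs of seller superhedging strategies. -/
def askPrice (ξ ζ : ℕ → Ω → ℝ) : ℝ :=
  sInf {x | ∃ α β, SellerHedge M ξ ζ α β ∧ ∀ ω, x = -liq M 0 ω (-α 0 ω) (-β 0 ω)}

/-- Buyer's (bid) price: supremum of the amounts raised by buyer superhedging strategies. -/
def bidPrice (ξ ζ : ℕ → Ω → ℝ) : ℝ :=
  sSup {x | ∃ α β, BuyerHedge M ξ ζ α β ∧ ∀ ω, x = liq M 0 ω (-α 0 ω) (-β 0 ω)}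

/-- Mixed stopping time. -/
def IsMixedStop (χ : ℕ → Ω → ℝ) : Prop :=
  (∀ t, t ≤ M.T → Measurable[M.F t] (χ t)) ∧ (∀ t ω, 0 ≤ χ t ω) ∧
  ∀ ω, ∑ t ∈ Finset.range (M.T + 1), χ t ω = 1

/-- χ*_t = Σ_{s=t}^T χ_s  (so χ*_{T+1} = 0). -/
def chiStar (χ : ℕ → Ω → ℝ) (t : ℕ) (ω : Ω) : ℝ := ∑ s ∈ Finset.Icc t M.T, χ s ω

/-- Z^{χ*}_t = Σ_{s=t}^T χ_s Z_s  (so Z^{χ*}_{T+1} = 0). -/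
def starVal (χ Z : ℕ → Ω → ℝ) (t : ℕ) (ω : Ω) : ℝ :=
  ∑ s ∈ Finset.Icc t M.T, χ s ω * Z s ω

/-- Z_χ = Σ_{t=0}^T χ_t Z_t. -/
def mixVal (χ Z : ℕ → Ω → ℝ) (ω : Ω) : ℝ :=
  ∑ t ∈ Finset.range (M.T + 1), χ t ω * Z t ω

/-- Membership in the family barP(χ). -/
def memBarP (χ : ℕ → Ω → ℝ) (P : Ω → ℝ) (S : ℕ → Ω → ℝ) : Prop :=
  (∀ ω, 0 ≤ P ω) ∧ (∑ ω, P ω) = 1 ∧ IsAdapted M S ∧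
  (∀ t ω, t ≤ M.T → M.Sb t ω ≤ S t ω ∧ S t ω ≤ M.Sa t ω) ∧
  (∀ t, t ≤ M.T → ∀ ω, 0 < P ω →
    chiStar M χ (t + 1) ω * M.Sb t ω ≤ condExp (M.F t) P (starVal M χ S (t + 1)) ω ∧
    condExp (M.F t) P (starVal M χ S (t + 1)) ω ≤ chiStar M χ (t + 1) ω * M.Sa t ω)

/-- Membership in the family P(χ): barP(χ) with P equivalent to Q. -/
def memP (χ : ℕ → Ω → ℝ) (P : Ω → ℝ) (S : ℕ → Ω → ℝ) : Prop :=
  memBarP M χ P S ∧ ∀ ω, 0 < P ω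

/-- The mixed stopping time χ^τ associated with a pure stopping time τ. -/
def pureChi (τ : Ω → ℕ) : ℕ → Ω → ℝ := fun t ω => if τ ω = t then 1 else 0

/-- Arbitrage-free: there is an equivalent probability measure and a martingale
between the bid and ask prices. -/
def ArbitrageFree : Prop :=
  ∃ (P : Ω → ℝ) (S : ℕ → Ω → ℝ),
    (∀ ω, 0 < P ω) ∧ (∑ ω, P ω) = 1 ∧ IsAdapted M S ∧
    (∀ t ω, t ≤ M.T → M.Sb t ω ≤ S t ω ∧ S t ω ≤ M.Sa t ω) ∧
    (∀ t, t < M.T → ∀ ω, 0 < P ω → condExp (M.F t) P (S (t + 1)) ω = S t ω)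

/-- Epigraph of a function ℝ → ℝ, as a subset of ℝ² (first coordinate dominates). -/
def epi (f : ℝ → ℝ) : Set (ℝ × ℝ) := {p | f p.2 ≤ p.1}

/-- The function h_{[b,a]}(y) = a y⁻ − b y⁺. -/
def hfun (b a : ℝ) (y : ℝ) : ℝ := a * max (-y) 0 - b * max y 0

/-- Seller's payoff function u_t(y) = ξ_t + (y − ζ_t)⁻ S^a_t − (y − ζ_t)⁺ S^b_t. -/
def uSell (ξ ζ : ℕ → Ω → ℝ) (t : ℕ) (ω : Ω) (y : ℝ) : ℝ :=
  ξ t ω + M.Sa t ω * max (ζ t ω - y) 0 - M.Sb t ω * max (y - ζ t ω) 0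

/-- Buyer's payoff function u_t(y) = −ξ_t + (y + ζ_t)⁻ S^a_t − (y + ζ_t)⁺ S^b_t. -/
def uBuy (ξ ζ : ℕ → Ω → ℝ) (t : ℕ) (ω : Ω) (y : ℝ) : ℝ :=
  -ξ t ω + M.Sa t ω * max (-(y + ζ t ω)) 0 - M.Sb t ω * max (y + ζ t ω) 0

/-- The seller's pricing recursion: one function per atom,
`z_T = u_T` and `epi z_{t-1} = epi u_{t-1} ∩ (epi h + ⋂_{succ} epi z_t)`. -/
def SellerRec (ξ ζ : ℕ → Ω → ℝ) (z : ℕ → Ω → ℝ → ℝ) : Prop :=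
  (∀ t ω ω', t ≤ M.T → sameAtom (M.F t) ω ω' → z t ω = z t ω') ∧
  (∀ ω, z M.T ω = uSell M ξ ζ M.T ω) ∧
  (∀ t ω, t < M.T →
    epi (z t ω) = epi (uSell M ξ ζ t ω) ∩
      (epi (hfun (M.Sb t ω) (M.Sa t ω)) +
        ⋂ ω' ∈ {ω'' | sameAtom (M.F t) ω ω''}, epi (z (t + 1) ω')))

/-- The buyer's pricing recursion: one function per atom,
`z_T = u_T` and `epi z_{t-1} = epi u_{t-1} ∪ (epi h + ⋂_{succ} epi z_t)`. -/
def BuyerRec (ξ ζ : ℕ → Ω → ℝ) (z : ℕ → Ω → ℝ → ℝ) : Prop :=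
  (∀ t ω ω', t ≤ M.T → sameAtom (M.F t) ω ω' → z t ω = z t ω') ∧
  (∀ ω, z M.T ω = uBuy M ξ ζ M.T ω) ∧
  (∀ t ω, t < M.T →
    epi (z t ω) = epi (uBuy M ξ ζ t ω) ∪
      (epi (hfun (M.Sb t ω) (M.Sa t ω)) +
        ⋂ ω' ∈ {ω'' | sameAtom (M.F t) ω ω''}, epi (z (t + 1) ω')))

theorem sameAtom.symm {X : Type*} {m : MeasurableSpace X} {ω ω' : X} (h : sameAtom m ω ω') :
    sameAtom m ω' ω := fun A hA => (h A hA).symm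

theorem sameAtom.congr_left {X : Type*} {m : MeasurableSpace X} {ω ω' : X} (h : sameAtom m ω ω') :
    {ω'' | sameAtom m ω ω''} = {ω'' | sameAtom m ω' ω''} := by
  ext ω''
  exact ⟨fun k A hA => (h A hA).symm.trans (k A hA), fun k A hA => (h A hA).trans (k A hA)⟩

theorem sameAtom.apply_eq {X : Type*} {m : MeasurableSpace X} {ω ω' : X} (h : sameAtom m ω ω')
    {d : X → ℝ} (hd : Measurable[m] d) : d ω' = d ω := by
  have := h (d ⁻¹' {d ω}) (hd (measurableSet_singleton _))
  simpa using this

theorem sameAtom_bot {X : Type*} (ω ω' : X) : sameAtom ⊥ ω ω' := by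
  intro A hA
  rcases MeasurableSpace.measurableSet_bot_iff.1 hA with rfl | rfl <;> simp

/-- Defining property of the conditional expectation, tested against measurable `d`. -/
theorem expect_condExp_mul (m : MeasurableSpace Ω) {P : Ω → ℝ} (hP : ∀ ω, 0 ≤ P ω)
    (f : Ω → ℝ) {d : Ω → ℝ} (hd : Measurable[m] d) :
    expect P (fun ω => condExp m P f ω * d ω) = expect P (fun ω => f ω * d ω) := by
  classical
  set A : Ω → ℝ := fun ω => ∑ ω' : Ω, Set.indicator {ω'' | sameAtom m ω ω''} P ω' with hA
  have key : ∀ ω ω', P ω * (Set.indicator {ω'' | sameAtom m ω ω''} (fun ω'' => P ω'' * f ω'') ω' /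
        A ω * d ω) =
      P ω' * f ω' * d ω' / A ω' * Set.indicator {ω'' | sameAtom m ω' ω''} P ω := by
    intro ω ω'
    by_cases h : sameAtom m ω ω'
    · have e : A ω' = A ω := by simp only [hA, h.congr_left]
      simp only [Set.indicator, Set.mem_ofPred_eq, h, h.symm, if_true, h.apply_eq hd, e]
      ring
    · have h' : ¬ sameAtom m ω' ω := fun k => h k.symm
      simp [Set.indicator, h, h']
  unfold expect condExp
  simp only [Finset.sum_div, Finset.sum_mul, Finset.mul_sum]
  change ∑ ω, ∑ ω', P ω * (Set.indicator {ω'' | sameAtom m ω ω''} (fun ω'' => P ω'' * f ω'') ω' /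
        A ω * d ω) = _
  simp only [key]
  rw [Finset.sum_comm]
  refine Finset.sum_congr rfl fun ω _ => ?_
  rw [← Finset.mul_sum]
  change P ω * f ω * d ω / A ω * A ω = _
  rcases (hP ω).eq_or_lt with h | h
  · simp [← h]
  · have hpos : 0 < A ω := by
      refine lt_of_lt_of_le h ?_
      have := Finset.single_le_sum
        (f := fun ω' => Set.indicator {ω'' | sameAtom m ω ω''} P ω')
        (fun ω' _ => Set.indicator_nonneg (fun x _ => hP x) ω') (Finset.mem_univ ω)
      have hω : sameAtom m ω ω := fun _ _ => Iff.rfl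
      exact (Set.indicator_of_mem (s := {ω'' | sameAtom m ω ω''}) hω P).symm.le.trans this
    field_simp

/-- The liquidation value is dominated by the value at any price in the bid-ask interval. -/
theorem mul_liq_le {t : ℕ} {ω : Ω} {c C : ℝ} (hb : c * M.Sb t ω ≤ C) (ha : C ≤ c * M.Sa t ω)
    (γ δ : ℝ) : c * liq M t ω γ δ ≤ c * γ + C * δ := by
  unfold liq
  have h1 : δ = max δ 0 - max (-δ) 0 := by
    rcases le_total 0 δ with h | h
    · simp [h]
    · simp [h]
  have h2 := mul_le_mul_of_nonneg_right hb (le_max_right δ 0)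
  have h3 := mul_le_mul_of_nonneg_right ha (le_max_right (-δ) 0)
  have h4 : C * δ = C * max δ 0 - C * max (-δ) 0 := by rw [← mul_sub, ← h1]
  rw [h4]
  linarith

theorem expect_mono {P : Ω → ℝ} (hP : ∀ ω, 0 ≤ P ω) {f g : Ω → ℝ}
    (h : ∀ ω, 0 < P ω → f ω ≤ g ω) : expect P f ≤ expect P g := by
  refine Finset.sum_le_sum fun ω _ => ?_
  rcases (hP ω).eq_or_lt with h0 | h0
  · simp [← h0]
  · exact mul_le_mul_of_nonneg_left (h ω h0) h0.le

theorem expect_add (P f g : Ω → ℝ) :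
    expect P (fun ω => f ω + g ω) = expect P f + expect P g := by
  simp [expect, mul_add, Finset.sum_add_distrib]

theorem expect_const {P : Ω → ℝ} (hP : ∑ ω, P ω = 1) (c : ℝ) : expect P (fun _ => c) = c := by
  simp [expect, ← Finset.sum_mul, hP]

theorem starVal_eq_add (χ Z : ℕ → Ω → ℝ) {t : ℕ} (ht : t ≤ M.T) (ω : Ω) :
    starVal M χ Z t ω = χ t ω * Z t ω + starVal M χ Z (t + 1) ω := by
  unfold starVal
  rw [← Finset.insert_Icc_add_one_left_eq_Icc ht, Finset.sum_insert (by simp)]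

theorem chiStar_eq_add (χ : ℕ → Ω → ℝ) {t : ℕ} (ht : t ≤ M.T) (ω : Ω) :
    chiStar M χ t ω = χ t ω + chiStar M χ (t + 1) ω := by
  unfold chiStar
  rw [← Finset.insert_Icc_add_one_left_eq_Icc ht, Finset.sum_insert (by simp)]

theorem chiStar_zero {χ : ℕ → Ω → ℝ} (hχ : IsMixedStop M χ) (ω : Ω) : chiStar M χ 0 ω = 1 := by
  rw [← hχ.2.2 ω, chiStar, Finset.range_eq_Ico]
  rfl

theorem chiStar_nonneg {χ : ℕ → Ω → ℝ} (hχ : IsMixedStop M χ) (t : ℕ) (ω : Ω) :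
    0 ≤ chiStar M χ t ω := Finset.sum_nonneg fun s _ => hχ.2.1 s ω

theorem isStop_const {t : ℕ} (ht : t ≤ M.T) : IsStop M fun _ : Ω => t :=
  ⟨fun _ => ht, fun _ => MeasurableSet.const _⟩

variable {M}

theorem SelfFinancing.measurable_stock {α β : ℕ → Ω → ℝ} (h : SelfFinancing M α β) {t : ℕ}
    (ht : t ≤ M.T) : Measurable[M.F t] (β t) := by
  cases t with
  | zero => exact h.2.1
  | succ t => exact ((h.2.2.1 t ht).2).mono (M.F_mono t.le_succ) le_rfl

/-- Rebalancing a self-financing strategy does not increase its expected value under `(P, S)`. -/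
theorem SelfFinancing.expect_succ_le {α β χ S : ℕ → Ω → ℝ} {P : Ω → ℝ}
    (h : SelfFinancing M α β) (hχ : IsMixedStop M χ) (hPS : memBarP M χ P S) {t : ℕ}
    (ht : t < M.T) :
    expect P (fun ω => chiStar M χ (t + 1) ω * α (t + 1) ω +
        starVal M χ S (t + 1) ω * β (t + 1) ω) ≤
      expect P (fun ω => chiStar M χ (t + 1) ω * α t ω + starVal M χ S (t + 1) ω * β t ω) := by
  have hP := hPS.1
  rw [expect_add, expect_add, ← expect_condExp_mul (M.F t) hP _ (h.2.2.1 t ht).2,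
    ← expect_condExp_mul (M.F t) hP _ (h.measurable_stock ht.le), ← expect_add, ← expect_add]
  refine expect_mono hP fun ω hω => ?_
  obtain ⟨hb, ha⟩ := hPS.2.2.2.2 t ht.le ω hω
  have h1 := mul_liq_le M hb ha (α t ω - α (t + 1) ω) (β t ω - β (t + 1) ω)
  have h2 := mul_nonneg (chiStar_nonneg M hχ (t + 1) ω) (h.2.2.2 t ht ω)
  linarith

/-- The expected value of a superhedging strategy dominates that of the remaining payoff. -/
theorem SellerHedge.expect_starVal_le {ξ ζ α β χ S : ℕ → Ω → ℝ} {P : Ω → ℝ}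
    (h : SellerHedge M ξ ζ α β) (hχ : IsMixedStop M χ) (hPS : memBarP M χ P S) {t : ℕ}
    (ht : t ≤ M.T) :
    expect P (starVal M χ (fun t ω => ξ t ω + S t ω * ζ t ω) t) ≤
      expect P (fun ω => chiStar M χ t ω * α t ω + starVal M χ S t ω * β t ω) := by
  have pay : ∀ s ≤ M.T, ∀ ω, χ s ω * (ξ s ω + S s ω * ζ s ω) ≤
      χ s ω * α s ω + χ s ω * S s ω * β s ω := by
    intro s hs ω
    obtain ⟨hb, ha⟩ := hPS.2.2.2.1 s ω hs
    have h1 := h.2 _ (isStop_const M hs) ω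
    have h2 := mul_liq_le M (c := 1) (by simpa using hb) (by simpa using ha)
      (α s ω - ξ s ω) (β s ω - ζ s ω)
    have h3 := mul_le_mul_of_nonneg_left (a := χ s ω)
      (show ξ s ω + S s ω * ζ s ω ≤ α s ω + S s ω * β s ω by linarith) (hχ.2.1 s ω)
    linarith
  induction ht using Nat.decreasingInduction with
  | self =>
    refine expect_mono hPS.1 fun ω _ => ?_
    simpa [starVal, chiStar] using pay M.T le_rfl ω
  | of_succ t ht ih =>
    have h1 := ih.trans (h.1.expect_succ_le hχ hPS ht)
    have h2 := expect_mono hPS.1 fun ω _ => pay t ht.le ω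
    refine le_of_eq_of_le ?_ ((add_le_add h2 h1).trans_eq ?_)
    · rw [← expect_add]
      exact congrArg _ (funext fun ω => starVal_eq_add M _ _ ht.le ω)
    · rw [← expect_add]
      refine congrArg _ (funext fun ω => ?_)
      rw [starVal_eq_add M _ _ ht.le ω, chiStar_eq_add M _ ht.le ω]
      ring

variable (M)

/-- Proposition: if (α,β) superhedges the seller's position then for every mixed
stopping time χ and every (P,S) ∈ barP(χ), E_P((ξ + Sζ)_χ) ≤ −θ₀(−α₀,−β₀). -/
theorem seller_hedge_dominates_expectation (ξ ζ α β : ℕ → Ω → ℝ)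
    (hpay : AdaptedPair M ξ ζ) (hhedge : SellerHedge M ξ ζ α β)
    (χ : ℕ → Ω → ℝ) (hχ : IsMixedStop M χ)
    (P : Ω → ℝ) (S : ℕ → Ω → ℝ) (hPS : memBarP M χ P S) :
    ∀ ω, expect P (mixVal M χ fun t ω' => ξ t ω' + S t ω' * ζ t ω') ≤
      -liq M 0 ω (-α 0 ω) (-β 0 ω) := by
  intro ω₀
  have hP := hPS.1
  have h0 : (0 : ℕ) ≤ M.T := M.T.zero_le
  have const : ∀ {d : Ω → ℝ}, Measurable[M.F 0] d → ∀ ω, d ω = d ω₀ := fun hd ω =>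
    sameAtom.apply_eq (M.F_zero ▸ sameAtom_bot ω₀ ω) hd
  have hmix : mixVal M χ (fun t ω' => ξ t ω' + S t ω' * ζ t ω') =
      starVal M χ (fun t ω' => ξ t ω' + S t ω' * ζ t ω') 0 := by
    funext ω
    rw [mixVal, starVal, Finset.range_eq_Ico]
    rfl
  rw [hmix]
  refine (hhedge.expect_starVal_le hχ hPS h0).trans ?_
  have split : expect P (fun ω => chiStar M χ 0 ω * α 0 ω + starVal M χ S 0 ω * β 0 ω) =
      expect P (fun ω => α 0 ω + χ 0 ω * S 0 ω * β 0 ω +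
        condExp (M.F 0) P (starVal M χ S 1) ω * β 0 ω) := by
    rw [expect_add P (fun ω => α 0 ω + χ 0 ω * S 0 ω * β 0 ω),
      expect_condExp_mul _ hP _ hhedge.1.2.1, ← expect_add]
    refine congrArg _ (funext fun ω => ?_)
    rw [starVal_eq_add M _ _ h0 ω, chiStar_zero M hχ]
    ring
  rw [split, ← expect_const hPS.2.1 (-liq M 0 ω₀ (-α 0 ω₀) (-β 0 ω₀))]
  refine expect_mono hP fun ω hω => ?_
  obtain ⟨hb, ha⟩ := hPS.2.2.2.2 0 h0 ω hω
  obtain ⟨hSb, hSa⟩ := hPS.2.2.2.1 0 ω h0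
  have hsum : chiStar M χ (0 + 1) ω = 1 - χ 0 ω := by
    linarith [chiStar_eq_add M χ h0 ω, chiStar_zero M hχ ω]
  rw [hsum] at hb ha
  have hb' := mul_le_mul_of_nonneg_left hSb (hχ.2.1 0 ω)
  have ha' := mul_le_mul_of_nonneg_left hSa (hχ.2.1 0 ω)
  have key := mul_liq_le M (t := 0) (ω := ω) (c := 1)
    (C := χ 0 ω * S 0 ω + condExp (M.F 0) P (starVal M χ S (0 + 1)) ω)
    (by linarith) (by linarith) (-α 0 ω) (-β 0 ω)
  have hliq : liq M 0 ω (-α 0 ω) (-β 0 ω) = liq M 0 ω₀ (-α 0 ω₀) (-β 0 ω₀) := by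
    simp only [liq, const hhedge.1.1 ω, const hhedge.1.2.1 ω, const (M.Sb_adapted 0 h0) ω,
      const (M.Sa_adapted 0 h0) ω]
  rw [← hliq]
  linarith

end RZ
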